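/- For all α1, α2 ∈ K, the algebra D_3(α1,α2) satisfies the Hall identity: for all x, y, z ∈ D_3(α1,α2), [[x,y]², z] = 0, where [u,v] = u·v − v·u. In particular the Fomin–Kirillov algebra E_3 = D_3(0,0) satisfies the Hall identity. -/

import Mathlib

noncomputable section

open FreeAlgebra

/-- The defining relations of the PBW deformation `D₃(α₁, α₂)` of the Fomin–Kirillov
algebra `E₃`: with generators `a = ι K 0`, `b = ι K 1`, `c = ι K 2`, the relations are
`a² = b² = c² = α₁`, `ca + bc + ab = α₂` and `cb + ba + ac = α₂`. -/
inductive D3Rel (K : Type) [Field K] (α1 α2 : K) :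
    FreeAlgebra K (Fin 3) → FreeAlgebra K (Fin 3) → Prop
  | ra : D3Rel K α1 α2 (ι K (0 : Fin 3) * ι K (0 : Fin 3))
      (algebraMap K (FreeAlgebra K (Fin 3)) α1)
  | rb : D3Rel K α1 α2 (ι K (1 : Fin 3) * ι K (1 : Fin 3))
      (algebraMap K (FreeAlgebra K (Fin 3)) α1)
  | rc : D3Rel K α1 α2 (ι K (2 : Fin 3) * ι K (2 : Fin 3))
      (algebraMap K (FreeAlgebra K (Fin 3)) α1)
  | r1 : D3Rel K α1 α2
      (ι K (2 : Fin 3) * ι K (0 : Fin 3) + ι K (1 : Fin 3) * ι K (2 : Fin 3) +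
        ι K (0 : Fin 3) * ι K (1 : Fin 3))
      (algebraMap K (FreeAlgebra K (Fin 3)) α2)
  | r2 : D3Rel K α1 α2
      (ι K (2 : Fin 3) * ι K (1 : Fin 3) + ι K (1 : Fin 3) * ι K (0 : Fin 3) +
        ι K (0 : Fin 3) * ι K (2 : Fin 3))
      (algebraMap K (FreeAlgebra K (Fin 3)) α2)

/-- The algebra `D₃(α₁, α₂)`: the quotient of the free algebra `K⟨a,b,c⟩` by the two-sided
ideal generated by the relations above. -/
abbrev D3 (K : Type) [Field K] (α1 α2 : K) : Type := RingQuot (D3Rel K α1 α2)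

/-- The generator `a` of `D₃(α₁, α₂)`. -/
def D3a (K : Type) [Field K] (α1 α2 : K) : D3 K α1 α2 :=
  RingQuot.mkAlgHom K (D3Rel K α1 α2) (ι K (0 : Fin 3))

/-- The generator `b` of `D₃(α₁, α₂)`. -/
def D3b (K : Type) [Field K] (α1 α2 : K) : D3 K α1 α2 :=
  RingQuot.mkAlgHom K (D3Rel K α1 α2) (ι K (1 : Fin 3))

/-- The generator `c` of `D₃(α₁, α₂)`. -/
def D3c (K : Type) [Field K] (α1 α2 : K) : D3 K α1 α2 :=
  RingQuot.mkAlgHom K (D3Rel K α1 α2) (ι K (2 : Fin 3))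

/-- If a bilinear map sends all pairs from `s` into `N`, it does so for all pairs from the
span of `s`. -/
lemma LinearMap.apply_mem_of_mem_span {S M P : Type*} [CommSemiring S] [AddCommMonoid M]
    [Module S M] [AddCommMonoid P] [Module S P] (f : M →ₗ[S] M →ₗ[S] P) {s : Set M}
    {N : Submodule S P} (h : ∀ x ∈ s, ∀ y ∈ s, f x y ∈ N) {x y : M}
    (hx : x ∈ Submodule.span S s) (hy : y ∈ Submodule.span S s) : f x y ∈ N := by
  have hle : Submodule.map₂ f (Submodule.span S s) (Submodule.span S s) ≤ N := by
    rw [Submodule.map₂_span_span, Submodule.span_le]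
    rintro _ ⟨x, hx, y, hy, rfl⟩
    exact h x hx y hy
  exact hle (Submodule.apply_mem_map₂ f hx hy)

/-- Generators `a, b, c` of an algebra that satisfy the relations of `D₃(α₁, α₂)`. -/
structure IsD3Triple {K R : Type*} [Field K] [Ring R] [Algebra K R] (α1 α2 : K)
    (a b c : R) : Prop where
  ha : a * a = algebraMap K R α1
  hb : b * b = algebraMap K R α1
  hc : c * c = algebraMap K R α1
  h1 : c * a + b * c + a * b = algebraMap K R α2
  h2 : c * b + b * a + a * c = algebraMap K R α2
  adjoin_eq_top : Algebra.adjoin K {a, b, c} = ⊤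

namespace IsD3Triple

variable {K R : Type*} [Field K] [Ring R] [Algebra K R] {α1 α2 : K} {a b c : R}

instance : SMulCommClass (Subalgebra.center K R) R R where
  smul_comm z x y := by
    have := Subalgebra.mem_center_iff.1 z.2 x
    simp only [Subalgebra.smul_def, smul_eq_mul, ← mul_assoc, this]

lemma rotate (h : IsD3Triple α1 α2 a b c) : IsD3Triple α1 α2 b c a where
  ha := h.hb
  hb := h.hc
  hc := h.ha
  h1 := by rw [← h.h1]; abel
  h2 := by rw [← h.h2]; abel
  adjoin_eq_top := by
    rw [← h.adjoin_eq_top]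
    congr 1
    ext x
    simp only [Set.mem_insert_iff, Set.mem_singleton_iff]
    tauto

lemma mul_mul_eq (h : IsD3Triple α1 α2 a b c) :
    a * b * c = algebraMap K R α2 * c - algebraMap K R α1 * b - c * a * c := by
  linear_combination (norm := noncomm_ring) h.h1 * c - b * h.hc + Algebra.commutes α1 b

lemma mul_mul_reverse (h : IsD3Triple α1 α2 a b c) : c * b * a = a * b * c := by
  linear_combination (norm := noncomm_ring)
    c * h.h2 - h.hc * b - h.h1 * c + b * h.hc - Algebra.commutes α1 b - Algebra.commutes α2 c

lemma mem_center (h : IsD3Triple α1 α2 a b c) {z : R} (hza : a * z = z * a)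
    (hzb : b * z = z * b) (hzc : c * z = z * c) : z ∈ Subalgebra.center K R := by
  have hle : Algebra.adjoin K {a, b, c} ≤ Subalgebra.centralizer K {z} := by
    refine Algebra.adjoin_le ?_
    simp [Set.insert_subset_iff, Set.mem_centralizer_iff, hza, hzb, hzc]
  rw [h.adjoin_eq_top] at hle
  refine Subalgebra.mem_center_iff.2 fun x => ?_
  have := hle (Algebra.mem_top (x := x))
  simpa [Subalgebra.mem_centralizer_iff, eq_comm] using this

lemma anticomm_mem_center (h : IsD3Triple α1 α2 a b c) :
    a * b + b * a ∈ Subalgebra.center K R := by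
  refine h.mem_center ?_ ?_ ?_
  · linear_combination (norm := noncomm_ring) h.ha * b - b * h.ha + Algebra.commutes α1 b
  · linear_combination (norm := noncomm_ring) h.hb * a - a * h.hb + Algebra.commutes α1 a
  · linear_combination (norm := noncomm_ring) h.mul_mul_reverse - h.rotate.rotate.mul_mul_reverse

/-- `a * b * c` is a combination of `a, b, c` with central coefficients. -/
lemma mul_mul_eq_sum (h : IsD3Triple α1 α2 a b c) :
    a * b * c = algebraMap K R α2 * c + algebraMap K R α1 * (a - b) - (c * a + a * c) * c := by
  linear_combination (norm := noncomm_ring) h.mul_mul_eq + a * h.hc - Algebra.commutes α1 a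

lemma center_mul_mem (N : Submodule (Subalgebra.center K R) R) {z v : R}
    (hz : z ∈ Subalgebra.center K R) (hv : v ∈ N) : z * v ∈ N :=
  N.smul_mem ⟨z, hz⟩ hv

lemma span_monomials_eq_top (h : IsD3Triple α1 α2 a b c) :
    Submodule.span (Subalgebra.center K R) {1, a, b, c, a * b, b * c} = ⊤ := by
  set N := Submodule.span (Subalgebra.center K R) {1, a, b, c, a * b, b * c}
  have hp : algebraMap K R α1 ∈ Subalgebra.center K R := Subalgebra.algebraMap_mem _ _
  have hq : algebraMap K R α2 ∈ Subalgebra.center K R := Subalgebra.algebraMap_mem _ _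
  have ht := h.anticomm_mem_center
  have hs := h.rotate.anticomm_mem_center
  have hr := h.rotate.rotate.anticomm_mem_center
  have m1 : (1 : R) ∈ N := Submodule.subset_span (by simp)
  have ma : a ∈ N := Submodule.subset_span (by simp)
  have mb : b ∈ N := Submodule.subset_span (by simp)
  have mc : c ∈ N := Submodule.subset_span (by simp)
  have mab : a * b ∈ N := Submodule.subset_span (by simp)
  have mbc : b * c ∈ N := Submodule.subset_span (by simp)
  have mz {z : R} (hz : z ∈ Subalgebra.center K R) : z ∈ N := by
    simpa using center_mul_mem N hz m1
  have mca : c * a ∈ N := by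
    have : c * a = algebraMap K R α2 - a * b - b * c := by
      linear_combination (norm := noncomm_ring) h.h1
    rw [this]
    exact sub_mem (sub_mem (mz hq) mab) mbc
  have mac : a * c ∈ N := by
    have : a * c = (c * a + a * c) - c * a := by abel
    rw [this]
    exact sub_mem (mz hr) mca
  have mabc : a * b * c ∈ N := by
    rw [h.mul_mul_eq_sum]
    exact sub_mem (add_mem (center_mul_mem N hq mc) (center_mul_mem N hp (sub_mem ma mb)))
      (center_mul_mem N hr mc)
  have mba : b * a ∈ N := by
    have : b * a = (a * b + b * a) - a * b := by abel
    rw [this]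
    exact sub_mem (mz ht) mab
  have mcb : c * b ∈ N := by
    have : c * b = (b * c + c * b) - b * c := by abel
    rw [this]
    exact sub_mem (mz hs) mbc
  have of_gen {g : R} (hg : ∀ x ∈ ({1, a, b, c, a * b, b * c} : Set R), g * x ∈ N) :
      ∀ x ∈ N, g * x ∈ N := by
    intro x hx
    have hle : N ≤ N.comap (LinearMap.mulLeft (Subalgebra.center K R) g) :=
      Submodule.span_le.2 hg
    exact hle hx
  have left_mul : ∀ y ∈ Algebra.adjoin K {a, b, c}, ∀ x ∈ N, y * x ∈ N := by
    intro y hy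
    induction hy using Algebra.adjoin_induction with
    | mem g hg =>
      apply of_gen
      have hab : b * (a * b) = (a * b + b * a) * b - algebraMap K R α1 * a := by
        linear_combination (norm := noncomm_ring) -(a * h.hb) + Algebra.commutes α1 a
      have hbc : c * (b * c) = (b * c + c * b) * c - algebraMap K R α1 * b := by
        linear_combination (norm := noncomm_ring) -(b * h.hc) + Algebra.commutes α1 b
      have hcab : c * (a * b) = (a * b + b * a) * c - a * b * c := by
        linear_combination (norm := noncomm_ring) -h.rotate.rotate.mul_mul_reverse
      simp only [Set.mem_insert_iff, Set.mem_singleton_iff] at hg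
      rcases hg with rfl | rfl | rfl <;>
        simp only [Set.mem_insert_iff, Set.mem_singleton_iff, forall_eq_or_imp, forall_eq, mul_one]
      · refine ⟨ma, ?_, mab, mac, ?_, ?_⟩
        · rw [h.ha]; exact mz hp
        · rw [← mul_assoc, h.ha]; exact center_mul_mem N hp mb
        · rw [← mul_assoc]; exact mabc
      · refine ⟨mb, mba, ?_, mbc, ?_, ?_⟩
        · rw [h.hb]; exact mz hp
        · rw [hab]; exact sub_mem (center_mul_mem N ht mb) (center_mul_mem N hp ma)
        · rw [← mul_assoc, h.hb]; exact center_mul_mem N hp mc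
      · refine ⟨mc, mca, mcb, ?_, ?_, ?_⟩
        · rw [h.hc]; exact mz hp
        · rw [hcab]; exact sub_mem (center_mul_mem N ht mc) mabc
        · rw [hbc]; exact sub_mem (center_mul_mem N hs mc) (center_mul_mem N hp mb)
    | algebraMap k => exact fun x hx => center_mul_mem N (Subalgebra.algebraMap_mem _ k) hx
    | add y z _ _ hy hz => intro x hx; rw [add_mul]; exact add_mem (hy x hx) (hz x hx)
    | mul y z _ _ hy hz => intro x hx; rw [mul_assoc]; exact hy _ (hz x hx)
  refine eq_top_iff.2 fun y _ => ?_
  have hy : y ∈ Algebra.adjoin K {a, b, c} := h.adjoin_eq_top ▸ Algebra.mem_top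
  simpa using left_mul y hy 1 m1

/-- The span over the center of `a`, `b`, `c` and two of their commutators; it contains all
commutators. -/
def commutatorSpan (K : Type*) {R : Type*} [Field K] [Ring R] [Algebra K R] (a b c : R) :
    Submodule (Subalgebra.center K R) R :=
  Submodule.span _ {a, b, c, a * b - b * a, b * c - c * b}

lemma commutator_mem (h : IsD3Triple α1 α2 a b c) (x y : R) :
    x * y - y * x ∈ commutatorSpan K a b c := by
  set V := commutatorSpan K a b c
  have hp : algebraMap K R α1 ∈ Subalgebra.center K R := Subalgebra.algebraMap_mem _ _
  have hq : algebraMap K R α2 ∈ Subalgebra.center K R := Subalgebra.algebraMap_mem _ _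
  have ht := h.anticomm_mem_center
  have hs := h.rotate.anticomm_mem_center
  have hr := h.rotate.rotate.anticomm_mem_center
  have ma : a ∈ V := Submodule.subset_span (by simp)
  have mb : b ∈ V := Submodule.subset_span (by simp)
  have mc : c ∈ V := Submodule.subset_span (by simp)
  have mab : a * b - b * a ∈ V := Submodule.subset_span (by simp)
  have mbc : b * c - c * b ∈ V := Submodule.subset_span (by simp)
  have mabc : a * b * c ∈ V := by
    rw [h.mul_mul_eq_sum]
    exact sub_mem (add_mem (center_mul_mem V hq mc) (center_mul_mem V hp (sub_mem ma mb)))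
      (center_mul_mem V hr mc)
  have mac : a * c - c * a ∈ V := by
    have : a * c - c * a = (a * b - b * a) + (b * c - c * b) := by
      linear_combination (norm := noncomm_ring) h.h2 - h.h1
    rw [this]
    exact add_mem mab mbc
  have symm {x y : R} (hxy : x * y - y * x ∈ V) : y * x - x * y ∈ V := by
    simpa using neg_mem hxy
  have ma_ab : a * (a * b) - a * b * a ∈ V := by
    have : a * (a * b) - a * b * a =
        2 • (algebraMap K R α1 * b) - (a * b + b * a) * a := by
      linear_combination (norm := noncomm_ring) h.ha * b + b * h.ha - Algebra.commutes α1 b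
    rw [this]
    exact sub_mem (nsmul_mem (center_mul_mem V hp mb) 2) (center_mul_mem V ht ma)
  have mb_ab : b * (a * b) - a * b * b ∈ V := by
    have : b * (a * b) - a * b * b =
        (a * b + b * a) * b - 2 • (algebraMap K R α1 * a) := by
      linear_combination (norm := noncomm_ring) -2 * (a * h.hb) + 2 * Algebra.commutes α1 a
    rw [this]
    exact sub_mem (center_mul_mem V ht mb) (nsmul_mem (center_mul_mem V hp ma) 2)
  have mb_bc : b * (b * c) - b * c * b ∈ V := by
    have : b * (b * c) - b * c * b =
        2 • (algebraMap K R α1 * c) - (b * c + c * b) * b := by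
      linear_combination (norm := noncomm_ring) h.hb * c + c * h.hb - Algebra.commutes α1 c
    rw [this]
    exact sub_mem (nsmul_mem (center_mul_mem V hp mc) 2) (center_mul_mem V hs mb)
  have mc_bc : c * (b * c) - b * c * c ∈ V := by
    have : c * (b * c) - b * c * c =
        (b * c + c * b) * c - 2 • (algebraMap K R α1 * b) := by
      linear_combination (norm := noncomm_ring) -2 * (b * h.hc) + 2 * Algebra.commutes α1 b
    rw [this]
    exact sub_mem (center_mul_mem V hs mc) (nsmul_mem (center_mul_mem V hp mb) 2)
  have ma_bc : a * (b * c) - b * c * a ∈ V := by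
    have : a * (b * c) - b * c * a = 2 • (a * b * c) - (b * c + c * b) * a := by
      linear_combination (norm := noncomm_ring) h.mul_mul_reverse
    rw [this]
    exact sub_mem (nsmul_mem mabc 2) (center_mul_mem V hs ma)
  have mc_ab : c * (a * b) - a * b * c ∈ V := by
    have : c * (a * b) - a * b * c = (a * b + b * a) * c - 2 • (a * b * c) := by
      linear_combination (norm := noncomm_ring) -h.rotate.rotate.mul_mul_reverse
    rw [this]
    exact sub_mem (center_mul_mem V ht mc) (nsmul_mem mabc 2)
  have mab_bc : a * b * (b * c) - b * c * (a * b) ∈ V := by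
    have : a * b * (b * c) - b * c * (a * b) = 0 := by
      linear_combination (norm := noncomm_ring)
        a * h.hb * c - h.hb * a * c + b * h.rotate.rotate.mul_mul_reverse - Algebra.commutes α1 a * c
    rw [this]
    exact zero_mem V
  refine LinearMap.apply_mem_of_mem_span
    (LinearMap.mul (Subalgebra.center K R) R - (LinearMap.mul (Subalgebra.center K R) R).flip)
    (N := V) (s := {1, a, b, c, a * b, b * c}) ?_
    (h.span_monomials_eq_top ▸ Submodule.mem_top) (h.span_monomials_eq_top ▸ Submodule.mem_top)
  simp only [Set.mem_insert_iff, Set.mem_singleton_iff, forall_eq_or_imp, forall_eq,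
    LinearMap.sub_apply, LinearMap.flip_apply, LinearMap.mul_apply', mul_one, one_mul, sub_self,
    zero_mem, true_and, and_true]
  exact ⟨⟨mab, mac, ma_ab, ma_bc⟩, ⟨symm mab, mbc, mb_ab, mb_bc⟩,
    ⟨symm mac, symm mbc, mc_ab, mc_bc⟩, ⟨symm ma_ab, symm mb_ab, symm mc_ab, mab_bc⟩,
    symm ma_bc, symm mb_bc, symm mc_bc, symm mab_bc⟩

lemma anticommutator_mem_center (h : IsD3Triple α1 α2 a b c) {x y : R}
    (hx : x ∈ commutatorSpan K a b c) (hy : y ∈ commutatorSpan K a b c) :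
    x * y + y * x ∈ Subalgebra.center K R := by
  have hp : algebraMap K R α1 ∈ Subalgebra.center K R := Subalgebra.algebraMap_mem _ _
  have ht := h.anticomm_mem_center
  have hs := h.rotate.anticomm_mem_center
  have hr := h.rotate.rotate.anticomm_mem_center
  set N : Submodule (Subalgebra.center K R) R := Submodule.span _ {1} with hN
  have mem_iff {z : R} : z ∈ N ↔ z ∈ Subalgebra.center K R := by
    simp [hN, Submodule.mem_span_singleton, Subalgebra.smul_def]
  have symm {x y : R} (hxy : x * y + y * x ∈ N) : y * x + x * y ∈ N := by
    rwa [add_comm]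
  have maa : a * a + a * a ∈ N := by rw [mem_iff, h.ha]; exact add_mem hp hp
  have mbb : b * b + b * b ∈ N := by rw [mem_iff, h.hb]; exact add_mem hp hp
  have mcc : c * c + c * c ∈ N := by rw [mem_iff, h.hc]; exact add_mem hp hp
  have mab : a * b + b * a ∈ N := mem_iff.2 ht
  have mbc : b * c + c * b ∈ N := mem_iff.2 hs
  have mac : a * c + c * a ∈ N := symm (mem_iff.2 hr)
  have zero {x : R} (hx : x = 0) : x ∈ N := hx ▸ zero_mem N
  have ma_ab : a * (a * b - b * a) + (a * b - b * a) * a ∈ N := zero <| by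
    linear_combination (norm := noncomm_ring) h.ha * b - b * h.ha + Algebra.commutes α1 b
  have mb_ab : b * (a * b - b * a) + (a * b - b * a) * b ∈ N := zero <| by
    linear_combination (norm := noncomm_ring) a * h.hb - h.hb * a - Algebra.commutes α1 a
  have mb_bc : b * (b * c - c * b) + (b * c - c * b) * b ∈ N := zero <| by
    linear_combination (norm := noncomm_ring) h.hb * c - c * h.hb + Algebra.commutes α1 c
  have mc_bc : c * (b * c - c * b) + (b * c - c * b) * c ∈ N := zero <| by
    linear_combination (norm := noncomm_ring) b * h.hc - h.hc * b - Algebra.commutes α1 b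
  have ma_bc : a * (b * c - c * b) + (b * c - c * b) * a ∈ N := zero <| by
    linear_combination (norm := noncomm_ring) -h.mul_mul_reverse - h.rotate.mul_mul_reverse
  have mc_ab : c * (a * b - b * a) + (a * b - b * a) * c ∈ N := zero <| by
    linear_combination (norm := noncomm_ring)
      -h.mul_mul_reverse - h.rotate.rotate.mul_mul_reverse
  have comm_sq {x y : R} (hx : x * x = algebraMap K R α1) (hy : y * y = algebraMap K R α1)
      (hxy : x * y + y * x ∈ Subalgebra.center K R) :
      (x * y - y * x) * (x * y - y * x) + (x * y - y * x) * (x * y - y * x) ∈ N := by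
    have : (x * y - y * x) * (x * y - y * x) + (x * y - y * x) * (x * y - y * x) =
        2 • ((x * y + y * x) * (x * y + y * x)) -
          8 • (algebraMap K R α1 * algebraMap K R α1) := by
      linear_combination (norm := noncomm_ring) -4 * (x * hy * x + y * hx * y) -
        4 * (hx * algebraMap K R α1 + hy * algebraMap K R α1) -
        4 * (x * Algebra.commutes α1 x + y * Algebra.commutes α1 y)
    rw [mem_iff, this]
    exact sub_mem (nsmul_mem (mul_mem hxy hxy) 2) (nsmul_mem (mul_mem hp hp) 8)
  have mab_bc : (a * b - b * a) * (b * c - c * b) + (b * c - c * b) * (a * b - b * a) ∈ N := by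
    have : (a * b - b * a) * (b * c - c * b) + (b * c - c * b) * (a * b - b * a) =
        4 • (algebraMap K R α1 * (c * a + a * c)) -
          2 • ((a * b + b * a) * (b * c + c * b)) := by
      linear_combination (norm := noncomm_ring)
        3 * (a * h.hb * c) + c * h.hb * a + 3 * (b * h.rotate.mul_mul_reverse) +
        3 * (h.hb * c * a) - b * h.rotate.rotate.mul_mul_reverse + h.hb * a * c -
        h.mul_mul_reverse * b - b * h.mul_mul_reverse -
        3 * (Algebra.commutes α1 a * c) - Algebra.commutes α1 c * a
    rw [mem_iff, this]
    exact sub_mem (nsmul_mem (mul_mem hp hr) 4) (nsmul_mem (mul_mem ht hs) 2)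
  have key := LinearMap.apply_mem_of_mem_span
    (LinearMap.mul (Subalgebra.center K R) R + (LinearMap.mul (Subalgebra.center K R) R).flip)
    (N := N) (s := {a, b, c, a * b - b * a, b * c - c * b}) ?_ hx hy
  · exact mem_iff.1 key
  simp only [Set.mem_insert_iff, Set.mem_singleton_iff, forall_eq_or_imp, forall_eq,
    LinearMap.add_apply, LinearMap.flip_apply, LinearMap.mul_apply']
  exact ⟨⟨maa, mab, mac, ma_ab, ma_bc⟩, ⟨symm mab, mbb, mbc, mb_ab, mb_bc⟩,
    ⟨symm mac, symm mbc, mcc, mc_ab, mc_bc⟩,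
    ⟨symm ma_ab, symm mb_ab, symm mc_ab, comm_sq h.ha h.hb ht, mab_bc⟩,
    symm ma_bc, symm mb_bc, symm mc_bc, symm mab_bc, comm_sq h.hb h.hc hs⟩

theorem commutator_sq_mem_center (h : IsD3Triple α1 α2 a b c) (h2 : (2 : K) ≠ 0) (x y : R) :
    (x * y - y * x) ^ 2 ∈ Subalgebra.center K R := by
  have hu := h.commutator_mem x y
  have h4 := Subalgebra.smul_mem _ (h.anticommutator_mem_center hu hu) (2 : K)⁻¹
  rwa [← two_smul K, smul_smul, inv_mul_cancel₀ h2, one_smul, ← sq] at h4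

end IsD3Triple
/-- The generators of `D₃(α₁, α₂)` satisfy the defining relations. -/
lemma isD3Triple_D3 (K : Type) [Field K] (α1 α2 : K) :
    IsD3Triple α1 α2 (D3a K α1 α2) (D3b K α1 α2) (D3c K α1 α2) where
  ha := by simpa [D3a] using RingQuot.mkAlgHom_rel K (D3Rel.ra (K := K) (α1 := α1) (α2 := α2))
  hb := by simpa [D3b] using RingQuot.mkAlgHom_rel K (D3Rel.rb (K := K) (α1 := α1) (α2 := α2))
  hc := by simpa [D3c] using RingQuot.mkAlgHom_rel K (D3Rel.rc (K := K) (α1 := α1) (α2 := α2))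
  h1 := by
    simpa [D3a, D3b, D3c] using
      RingQuot.mkAlgHom_rel K (D3Rel.r1 (K := K) (α1 := α1) (α2 := α2))
  h2 := by
    simpa [D3a, D3b, D3c] using
      RingQuot.mkAlgHom_rel K (D3Rel.r2 (K := K) (α1 := α1) (α2 := α2))
  adjoin_eq_top := by
    have hset : ({D3a K α1 α2, D3b K α1 α2, D3c K α1 α2} : Set (D3 K α1 α2)) =
        RingQuot.mkAlgHom K (D3Rel K α1 α2) '' Set.range (ι K) := by
      ext x
      simp [D3a, D3b, D3c, Fin.exists_fin_succ, eq_comm]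
    rw [hset, ← AlgHom.map_adjoin, FreeAlgebra.adjoin_range_ι, Algebra.map_top,
      AlgHom.range_eq_top]
    exact RingQuot.mkAlgHom_surjective K _

theorem D3_hall_identity (K : Type) [Field K] [IsAlgClosed K] (hchar : ringChar K ≠ 2) :
    ∀ α1 α2 : K, ∀ x y z : D3 K α1 α2,
      (x * y - y * x) ^ 2 * z - z * (x * y - y * x) ^ 2 = 0 := by
  intro α1 α2 x y z
  have h2 : (2 : K) ≠ 0 := Ring.two_ne_zero hchar
  have h := (isD3Triple_D3 K α1 α2).commutator_sq_mem_center h2 x y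
  rw [← Subalgebra.mem_center_iff.1 h z, sub_self]
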